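/- arXiv:1706.09111 — 2 statements merged into one kernel-verified Lean document; each statement's English description precedes it below -/
import Mathlib

section
/- Let α₁, α₂ ∈ ℝ with α₁ ≠ 0 and 2α₂/(3α₁) ∉ ℤ. Then there exist constants c, C > 0, depending only on α₁ and α₂, such that for all integers k₁, k₂, k₃ with Φ(k₁,k₂,k₃) ≠ 0, one has c·⟨k₁+k₂⟩·⟨k₂+k₃⟩·⟨k₃+k₁⟩ ≤ |Φ(k₁,k₂,k₃)| ≤ C·⟨k₁+k₂⟩·⟨k₂+k₃⟩·⟨k₃+k₁⟩. -/
open scoped ENNReal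

/-- Japanese bracket `⟨x⟩ = 1 + |x|`. -/
noncomputable def jap (x : ℝ) : ℝ := 1 + |x|

/-- The resonance function `Φ(k₁,k₂,k₃)` of the third order dispersion
relation `k ↦ α₁k³ + α₂k²`. -/
noncomputable def resPhi (α₁ α₂ : ℝ) (k₁ k₂ k₃ : ℤ) : ℝ :=
  (α₁ * ((k₁ : ℝ) + k₂ + k₃) ^ 3 + α₂ * ((k₁ : ℝ) + k₂ + k₃) ^ 2) -
    (α₁ * (k₁ : ℝ) ^ 3 + α₂ * (k₁ : ℝ) ^ 2) +
    (α₁ * (-(k₂ : ℝ)) ^ 3 + α₂ * (-(k₂ : ℝ)) ^ 2) -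
    (α₁ * (k₃ : ℝ) ^ 3 + α₂ * (k₃ : ℝ) ^ 2)

theorem resPhi_eq_mul {α₁ : ℝ} (α₂ : ℝ) (hα₁ : α₁ ≠ 0) (k₁ k₂ k₃ : ℤ) :
    resPhi α₁ α₂ k₁ k₂ k₃ =
      3 * α₁ * ((k₁ : ℝ) + k₂) * ((k₂ : ℝ) + k₃) * ((k₃ : ℝ) + k₁ + 2 * α₂ / (3 * α₁)) := by
  unfold resPhi
  field_simp
  ring

theorem jap_pos (x : ℝ) : 0 < jap x := by
  unfold jap
  positivity

theorem abs_le_jap (x : ℝ) : |x| ≤ jap x := by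
  unfold jap
  linarith

theorem jap_intCast_le {n : ℤ} (hn : (n : ℝ) ≠ 0) : jap n ≤ 2 * |(n : ℝ)| := by
  have h : (1 : ℝ) ≤ |(n : ℝ)| := by
    exact_mod_cast Int.one_le_abs (Int.cast_ne_zero.mp hn)
  unfold jap
  linarith

theorem abs_add_le_mul_jap (x μ : ℝ) : |x + μ| ≤ (1 + |μ|) * jap x := by
  have h := abs_add_le x μ
  unfold jap
  nlinarith [mul_nonneg (abs_nonneg μ) (abs_nonneg x)]

/-- A translate of `ℤ` avoiding `0` stays comparable to the Japanese bracket. -/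
theorem exists_jap_intCast_le_mul_abs_add {μ : ℝ} (hμ : ∀ n : ℤ, μ ≠ n) :
    ∃ A : ℝ, 0 < A ∧ ∀ n : ℤ, jap n ≤ A * |(n : ℝ) + μ| := by
  have hδ : 0 < |μ - round μ| := abs_pos.mpr (sub_ne_zero.mpr (hμ _))
  refine ⟨(1 + |μ|) / |μ - round μ| + 1, by positivity, fun n => ?_⟩
  have hdist : |μ - round μ| ≤ |(n : ℝ) + μ| := by
    have h := round_le μ (-n)
    rwa [Int.cast_neg, sub_neg_eq_add, add_comm] at h
  have hmul : 1 + |μ| ≤ (1 + |μ|) / |μ - round μ| * |(n : ℝ) + μ| := by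
    calc 1 + |μ| = (1 + |μ|) / |μ - round μ| * |μ - round μ| := by field_simp
      _ ≤ _ := by gcongr
  have htri : |(n : ℝ)| ≤ |(n : ℝ) + μ| + |μ| := by
    simpa using abs_sub ((n : ℝ) + μ) μ
  unfold jap
  linarith

/-- Two-sided bound on the resonance function off the resonant set (2.9) / `est:Phi`. -/
theorem stmt13 (α₁ α₂ : ℝ) (hα₁ : α₁ ≠ 0)
    (hres : ∀ n : ℤ, 2 * α₂ / (3 * α₁) ≠ (n : ℝ)) :
    ∃ c C : ℝ, 0 < c ∧ 0 < C ∧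
      ∀ k₁ k₂ k₃ : ℤ, resPhi α₁ α₂ k₁ k₂ k₃ ≠ 0 →
        c * jap ((k₁ : ℝ) + k₂) * jap ((k₂ : ℝ) + k₃) * jap ((k₃ : ℝ) + k₁) ≤
            |resPhi α₁ α₂ k₁ k₂ k₃| ∧
          |resPhi α₁ α₂ k₁ k₂ k₃| ≤
            C * jap ((k₁ : ℝ) + k₂) * jap ((k₂ : ℝ) + k₃) * jap ((k₃ : ℝ) + k₁) := by
  obtain ⟨A, hA, hjap⟩ := exists_jap_intCast_le_mul_abs_add hres
  have hα : 0 < |α₁| := abs_pos.mpr hα₁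
  refine ⟨3 * |α₁| / (4 * A), 3 * |α₁| * (1 + |2 * α₂ / (3 * α₁)|), by positivity,
    by positivity, fun k₁ k₂ k₃ hΦ => ?_⟩
  rw [resPhi_eq_mul α₂ hα₁] at hΦ ⊢
  have h₁₂ : (k₁ : ℝ) + k₂ ≠ 0 := fun h => hΦ (by simp [h])
  have h₂₃ : (k₂ : ℝ) + k₃ ≠ 0 := fun h => hΦ (by simp [h])
  have hb₁₂ : jap ((k₁ : ℝ) + k₂) ≤ 2 * |(k₁ : ℝ) + k₂| := by
    exact_mod_cast jap_intCast_le (n := k₁ + k₂) (by exact_mod_cast h₁₂)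
  have hb₂₃ : jap ((k₂ : ℝ) + k₃) ≤ 2 * |(k₂ : ℝ) + k₃| := by
    exact_mod_cast jap_intCast_le (n := k₂ + k₃) (by exact_mod_cast h₂₃)
  have hb₃₁ : jap ((k₃ : ℝ) + k₁) ≤ A * |(k₃ : ℝ) + k₁ + 2 * α₂ / (3 * α₁)| := by
    have h := hjap (k₃ + k₁)
    rwa [Int.cast_add] at h
  have hp₁₂ := jap_pos ((k₁ : ℝ) + k₂)
  have hp₂₃ := jap_pos ((k₂ : ℝ) + k₃)
  have hp₃₁ := jap_pos ((k₃ : ℝ) + k₁)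
  simp only [abs_mul, abs_of_pos (three_pos : (0 : ℝ) < 3)]
  constructor
  · calc _ ≤ 3 * |α₁| / (4 * A) * (2 * |(k₁ : ℝ) + k₂|) * (2 * |(k₂ : ℝ) + k₃|) *
          (A * |(k₃ : ℝ) + k₁ + 2 * α₂ / (3 * α₁)|) := by gcongr
      _ = _ := by
        generalize |(k₃ : ℝ) + k₁ + 2 * α₂ / (3 * α₁)| = w
        field_simp
        ring
  · calc _ ≤ 3 * |α₁| * jap ((k₁ : ℝ) + k₂) * jap ((k₂ : ℝ) + k₃) *
          ((1 + |2 * α₂ / (3 * α₁)|) * jap ((k₃ : ℝ) + k₁)) := by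
          gcongr
          · exact abs_le_jap _
          · exact abs_le_jap _
          · exact abs_add_le_mul_jap _ _
      _ = _ := by ring
end

section
/- For every ε > 0 there exists a constant C > 0 such that for all sequences f₁, f₂, f₃ : ℤ → [0,∞), sup_{k∈ℤ} ∑_{k₁+k₂+k₃=k} f₁(k₁)·f₂(k₂)·f₃(k₃)/⟨k₂+k₃⟩ ≤ C·(∑_{k∈ℤ} f₁(k)²)^{1/2}·(∑_{k∈ℤ} ⟨k⟩^{1+2ε} f₂(k)²)^{1/2}·sup_{k∈ℤ} f₃(k), where the sum on the left is over all triples (k₁,k₂,k₃) ∈ ℤ³ with k₁+k₂+k₃ = k. -/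
open scoped ENNReal

/-- The negative powers of the Japanese bracket of order greater than one are summable over `ℤ`. -/
theorem tsum_inv_jap_rpow_ne_top {s : ℝ} (hs : 1 < s) :
    ∑' k : ℤ, (ENNReal.ofReal (jap (k : ℝ) ^ s))⁻¹ ≠ ⊤ := by
  have hsum : Summable fun k : ℤ => jap (k : ℝ) ^ (-s) := by
    refine Summable.of_norm_bounded_eventually (Real.summable_abs_int_rpow hs) ?_
    filter_upwards [(Set.finite_singleton (0 : ℤ)).compl_mem_cofinite] with k hk
    have hk0 : (0 : ℝ) < |(k : ℝ)| := abs_pos.2 (Int.cast_ne_zero.2 hk)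
    rw [Real.norm_of_nonneg (Real.rpow_nonneg (jap_pos _).le _)]
    exact Real.rpow_le_rpow_of_nonpos hk0 (by unfold jap; linarith) (by linarith)
  convert hsum.tsum_ofReal_ne_top using 4 with k
  rw [Real.rpow_neg (jap_pos _).le,
    ENNReal.ofReal_inv_of_pos (Real.rpow_pos_of_pos (jap_pos _) _)]

/-- Cauchy–Schwarz for infinite sums in `ℝ≥0∞`. -/
theorem ennreal_tsum_mul_le_sqrt_mul_sqrt {ι : Type*} (f g : ι → ℝ≥0∞) :
    ∑' i, f i * g i ≤ (∑' i, f i ^ 2) ^ (1 / 2 : ℝ) * (∑' i, g i ^ 2) ^ (1 / 2 : ℝ) := by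
  rw [ENNReal.tsum_eq_iSup_sum]
  refine iSup_le fun s => (ENNReal.inner_le_Lp_mul_Lq s f g Real.HolderConjugate.two_two).trans ?_
  simp_rw [ENNReal.rpow_two]
  gcongr <;> exact ENNReal.sum_le_tsum s

/-- Cauchy–Schwarz with a weight `v`. -/
theorem ennreal_tsum_le_weighted {ι : Type*} (f v : ι → ℝ≥0∞) (hv0 : ∀ i, v i ≠ 0)
    (hvt : ∀ i, v i ≠ ⊤) :
    ∑' i, f i ≤ (∑' i, v i * f i ^ 2) ^ (1 / 2 : ℝ) * (∑' i, (v i)⁻¹) ^ (1 / 2 : ℝ) := by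
  have hsq (x : ℝ≥0∞) : (x ^ (1 / 2 : ℝ)) ^ 2 = x := by
    rw [← ENNReal.rpow_two, ← ENNReal.rpow_mul]
    norm_num
  calc ∑' i, f i = ∑' i, (v i ^ (1 / 2 : ℝ) * f i) * (v i)⁻¹ ^ (1 / 2 : ℝ) := by
        refine tsum_congr fun i => ?_
        rw [mul_right_comm, ← ENNReal.mul_rpow_of_nonneg _ _ (by norm_num),
          ENNReal.mul_inv_cancel (hv0 i) (hvt i), ENNReal.one_rpow, one_mul]
    _ ≤ _ := ennreal_tsum_mul_le_sqrt_mul_sqrt _ _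
    _ = _ := by simp_rw [mul_pow, hsq]

/-- The trilinear convolution estimate with the `⟨k₂+k₃⟩⁻¹` weight
(used in Lemma 3.2 / `lem:multilinear'`). -/
theorem stmt17 (ε : ℝ) (hε : 0 < ε) :
    ∃ C : ℝ, 0 < C ∧ ∀ f₁ f₂ f₃ : ℤ → ℝ≥0∞,
      (⨆ k : ℤ, ∑' p : ℤ × ℤ,
          f₁ p.1 * f₂ p.2 * f₃ (k - p.1 - p.2) / ENNReal.ofReal (jap ((k : ℝ) - p.1))) ≤
        ENNReal.ofReal C * (∑' k : ℤ, f₁ k ^ 2) ^ (1 / 2 : ℝ) *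
          (∑' k : ℤ, ENNReal.ofReal (jap (k : ℝ) ^ (1 + 2 * ε)) * f₂ k ^ 2) ^ (1 / 2 : ℝ) *
          ⨆ k : ℤ, f₃ k := by
  set A : ℝ≥0∞ := ∑' k : ℤ, (ENNReal.ofReal (jap (k : ℝ) ^ (2 : ℝ)))⁻¹ with hA
  set B : ℝ≥0∞ := ∑' k : ℤ, (ENNReal.ofReal (jap (k : ℝ) ^ (1 + 2 * ε)))⁻¹
  have hAt : A ≠ ⊤ := tsum_inv_jap_rpow_ne_top one_lt_two
  have hBt : B ≠ ⊤ := tsum_inv_jap_rpow_ne_top (by linarith)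
  have hK : A ^ (1 / 2 : ℝ) * B ^ (1 / 2 : ℝ) ≠ ⊤ := by
    have h2 : (0 : ℝ) ≤ 1 / 2 := by norm_num
    exact ENNReal.mul_ne_top (ENNReal.rpow_ne_top_of_nonneg h2 hAt)
      (ENNReal.rpow_ne_top_of_nonneg h2 hBt)
  refine ⟨(A ^ (1 / 2 : ℝ) * B ^ (1 / 2 : ℝ)).toReal + 1, by positivity,
    fun f₁ f₂ f₃ => iSup_le fun k => ?_⟩
  have hC : A ^ (1 / 2 : ℝ) * B ^ (1 / 2 : ℝ) ≤
      ENNReal.ofReal ((A ^ (1 / 2 : ℝ) * B ^ (1 / 2 : ℝ)).toReal + 1) :=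
    (ENNReal.le_ofReal_iff_toReal_le hK (by positivity)).2 (by linarith)
  set M : ℝ≥0∞ := ⨆ k : ℤ, f₃ k
  have h₁ : ∑' a : ℤ, f₁ a * (ENNReal.ofReal (jap ((k : ℝ) - a)))⁻¹ ≤
      (∑' a : ℤ, f₁ a ^ 2) ^ (1 / 2 : ℝ) * A ^ (1 / 2 : ℝ) := by
    have hshift : ∑' a : ℤ, (ENNReal.ofReal (jap ((k : ℝ) - a)))⁻¹ ^ 2 = A := by
      rw [hA, ← (Equiv.subLeft k).tsum_eq]
      refine tsum_congr fun a => ?_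
      rw [← ENNReal.inv_pow, ← ENNReal.ofReal_pow (jap_pos _).le, Real.rpow_two,
        Equiv.subLeft_apply, Int.cast_sub, sub_sub_cancel]
    rw [← hshift]
    exact ennreal_tsum_mul_le_sqrt_mul_sqrt _ _
  have h₂ : ∑' b : ℤ, f₂ b ≤
      (∑' b : ℤ, ENNReal.ofReal (jap (b : ℝ) ^ (1 + 2 * ε)) * f₂ b ^ 2) ^ (1 / 2 : ℝ) *
        B ^ (1 / 2 : ℝ) :=
    ennreal_tsum_le_weighted _ _
      (fun b => (ENNReal.ofReal_pos.2 (Real.rpow_pos_of_pos (jap_pos _) _)).ne')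
      fun b => ENNReal.ofReal_ne_top
  calc ∑' p : ℤ × ℤ, f₁ p.1 * f₂ p.2 * f₃ (k - p.1 - p.2) / ENNReal.ofReal (jap ((k : ℝ) - p.1))
      ≤ ∑' p : ℤ × ℤ, (f₁ p.1 * (ENNReal.ofReal (jap ((k : ℝ) - p.1)))⁻¹) * (f₂ p.2 * M) := by
        refine ENNReal.tsum_le_tsum fun p => ?_
        calc _ ≤ f₁ p.1 * f₂ p.2 * M / ENNReal.ofReal (jap ((k : ℝ) - p.1)) := by
              gcongr
              exact le_iSup f₃ _
          _ = _ := by rw [div_eq_mul_inv]; ring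
    _ = (∑' a : ℤ, f₁ a * (ENNReal.ofReal (jap ((k : ℝ) - a)))⁻¹) * ((∑' b : ℤ, f₂ b) * M) := by
        rw [ENNReal.tsum_prod (f := fun a b : ℤ =>
          (f₁ a * (ENNReal.ofReal (jap ((k : ℝ) - a)))⁻¹) * (f₂ b * M))]
        simp_rw [ENNReal.tsum_mul_left, ENNReal.tsum_mul_right]
    _ ≤ ((∑' a : ℤ, f₁ a ^ 2) ^ (1 / 2 : ℝ) * A ^ (1 / 2 : ℝ)) *
          (((∑' b : ℤ, ENNReal.ofReal (jap (b : ℝ) ^ (1 + 2 * ε)) * f₂ b ^ 2) ^ (1 / 2 : ℝ) *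
            B ^ (1 / 2 : ℝ)) * M) := by gcongr
    _ = A ^ (1 / 2 : ℝ) * B ^ (1 / 2 : ℝ) * (∑' a : ℤ, f₁ a ^ 2) ^ (1 / 2 : ℝ) *
          (∑' b : ℤ, ENNReal.ofReal (jap (b : ℝ) ^ (1 + 2 * ε)) * f₂ b ^ 2) ^ (1 / 2 : ℝ) *
          M := by ring
    _ ≤ _ := by gcongr
end
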